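/- Strong duality for the bTSc model (Eq. (34), bTSc case): if for the scalar κ there exists at least one bTSc-TAP-feasible triple and at least one bTSc-TVG-feasible triple for the goal price τ, then the supremum of the TAP objectives over all bTSc-TAP-feasible triples for κ equals the infimum of the bTSc objectives over all bTSc-TVG-feasible triples. -/

import Mathlib

open Finset

/-- A triple `(q, p, π)` is bTSc-TAP-feasible for the scalar `κ`. -/
def BTScTAPFeasible {J I R : Type*} [Fintype J] [Fintype I] [Fintype R]
    (x : I → J → ℝ) (y : R → J → ℝ) (o : J) (κ : ℝ)
    (q : I → ℝ) (p : R → ℝ) (π : J → ℝ) : Prop :=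
  (∀ i, 0 ≤ q i) ∧ (∀ r, 0 ≤ p r) ∧ (∀ j, 0 ≤ π j) ∧
  (∀ i, (∑ j, x i j * π j) + q i * x i o = x i o) ∧
  (∀ r, (∑ j, y r j * π j) - p r * y r o = y r o) ∧
  (∑ j, π j) = κ

/-- A triple `(v, u, w)` is bTSc-TVG-feasible for the goal price `τ`. -/
def BTScTVGFeasible {J I R : Type*} [Fintype J] [Fintype I] [Fintype R]
    (x : I → J → ℝ) (y : R → J → ℝ) (o : J) (τ : ℝ)
    (v : I → ℝ) (u : R → ℝ) (w : ℝ) : Prop :=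
  (∀ j, (∑ i, v i * x i j) - (∑ r, u r * y r j) + w ≥ 0) ∧
  (∀ i, x i o * v i ≥ τ) ∧ (∀ r, y r o * u r ≥ τ)

/-- Lagrange multipliers for a linear program over the standard simplex: if every point of the
simplex satisfying the constraints `0 ≤ ∑ j, A k j * π j` has objective value below `m`, and such
a point exists, then nonnegative multipliers certify the bound at every vertex. -/
theorem exists_multipliers_of_forall_stdSimplex_lt {J K : Type*} [Fintype J] [Fintype K]
    (A : K → J → ℝ) (c : J → ℝ) (m : ℝ)
    (hne : ∃ π ∈ stdSimplex ℝ J, ∀ k, 0 ≤ ∑ j, A k j * π j)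
    (hlt : ∀ π ∈ stdSimplex ℝ J, (∀ k, 0 ≤ ∑ j, A k j * π j) → ∑ j, c j * π j < m) :
    ∃ l : K → ℝ, (∀ k, 0 ≤ l k) ∧ ∀ j, (∑ k, l k * A k j) + c j < m := by
  classical
  let L : (J → ℝ) →ₗ[ℝ] (K → ℝ) × ℝ :=
    (Matrix.mulVecLin (Matrix.of A)).prod (Fintype.linearCombination ℝ c)
  have hL (π : J → ℝ) : L π = (fun k => ∑ j, A k j * π j, ∑ j, c j * π j) := by
    ext
    · simp [L, Matrix.mulVec, dotProduct]
    · simp [L, Fintype.linearCombination_apply, mul_comm]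
  let T : Set ((K → ℝ) × ℝ) := Set.Ici (0, m)
  have hdisj : Disjoint (L '' stdSimplex ℝ J) T := by
    rw [Set.disjoint_left]
    rintro _ ⟨π, hπ, rfl⟩ ⟨h₁, h₂⟩
    rw [hL] at h₁ h₂
    exact (hlt π hπ h₁).not_ge h₂
  obtain ⟨f, a, b, ha, hab, hb⟩ := geometric_hahn_banach_compact_closed
    ((convex_stdSimplex ℝ J).linear_image L)
    ((isCompact_stdSimplex ℝ J).image L.continuous_of_finiteDimensional)
    (convex_Ici (0, m)) isClosed_Ici hdisj
  have hnonneg (d : (K → ℝ) × ℝ) (hd : 0 ≤ d) : 0 ≤ f d := by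
    by_contra! hneg
    have hbase : b < f (0, m) := hb _ Set.self_mem_Ici
    let s := (f (0, m) - b) / (-f d)
    have hs0 : 0 ≤ s := div_nonneg (by linarith) (by linarith)
    have hmem := hb ((0, m) + s • d) (le_add_of_nonneg_right (smul_nonneg hs0 hd))
    rw [map_add, map_smul, smul_eq_mul] at hmem
    have : s * (-f d) = f (0, m) - b := div_mul_cancel₀ _ (by linarith)
    linarith
  let l : K → ℝ := fun k => f (Pi.single k 1, 0)
  let g : ℝ := f (0, 1)
  have hl (k : K) : 0 ≤ l k :=
    hnonneg _ ⟨Pi.single_nonneg.2 zero_le_one, le_rfl⟩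
  have hg : 0 ≤ g := hnonneg _ ⟨le_rfl, zero_le_one⟩
  have hf (d : K → ℝ) (t : ℝ) : f (d, t) = (∑ k, l k * d k) + g * t := by
    have hdecomp : (d, t) = (∑ k, d k • ((Pi.single k 1, 0) : (K → ℝ) × ℝ)) + t • (0, 1) := by
      ext k
      · simp [Prod.fst_sum, Finset.sum_apply, Pi.single_apply]
      · simp [Prod.snd_sum]
    rw [hdecomp, map_add, map_sum]
    simp only [map_smul, smul_eq_mul, l, g, mul_comm]
  have hsep (π : J → ℝ) (hπ : π ∈ stdSimplex ℝ J) :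
      (∑ k, l k * ∑ j, A k j * π j) + g * ∑ j, c j * π j < g * m := by
    have h₁ := ha _ ⟨π, hπ, rfl⟩
    have h₂ : b < f (0, m) := hb _ Set.self_mem_Ici
    rw [hL, hf] at h₁
    rw [hf] at h₂
    simp only [Pi.zero_apply, mul_zero, Finset.sum_const_zero, zero_add] at h₂
    linarith
  have hgpos : 0 < g := by
    obtain ⟨π, hπ, hfeas⟩ := hne
    have h₁ := hsep π hπ
    have h₂ : 0 ≤ ∑ k, l k * ∑ j, A k j * π j :=
      Finset.sum_nonneg fun k _ => mul_nonneg (hl k) (hfeas k)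
    refine hg.lt_of_ne fun h => ?_
    rw [← h] at h₁
    linarith
  refine ⟨fun k => l k / g, fun k => div_nonneg (hl k) hg, fun j => ?_⟩
  have h := hsep _ (single_mem_stdSimplex ℝ j)
  simp only [Pi.single_apply, mul_ite, mul_one, mul_zero, Finset.sum_ite_eq', Finset.mem_univ,
    if_true] at h
  have hsum : ∑ k, l k / g * A k j = (∑ k, l k * A k j) / g := by
    rw [Finset.sum_div]
    exact Finset.sum_congr rfl fun k _ => by ring
  rw [hsum, ← lt_sub_iff_add_lt, div_lt_iff₀ hgpos]
  linarith

section BTSc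

variable {J I R : Type*} [Fintype J] [Fintype I] [Fintype R]
  {x : I → J → ℝ} {y : R → J → ℝ} {o : J} {τ κ : ℝ}

/-- Weak duality for the bTSc model. -/
theorem BTScTAPFeasible.objective_le {q : I → ℝ} {p : R → ℝ} {π : J → ℝ}
    {v : I → ℝ} {u : R → ℝ} {w : ℝ}
    (hP : BTScTAPFeasible x y o κ q p π) (hD : BTScTVGFeasible x y o τ v u w) :
    τ * ((∑ i, q i) + ∑ r, p r) ≤ (∑ i, v i * x i o) - (∑ r, u r * y r o) + κ * w := by
  obtain ⟨hq, hp, hπ, hxo, hyo, hκ⟩ := hP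
  obtain ⟨hw, hv, hu⟩ := hD
  have hvx : ∑ i, v i * x i o = (∑ j, π j * ∑ i, v i * x i j) + ∑ i, q i * (x i o * v i) := by
    simp_rw [Finset.mul_sum]
    rw [Finset.sum_comm, ← Finset.sum_add_distrib]
    refine Finset.sum_congr rfl fun i _ => ?_
    conv_lhs => rw [← hxo i]
    rw [mul_add, Finset.mul_sum]
    congr 1
    · exact Finset.sum_congr rfl fun j _ => by ring
    · ring
  have huy : ∑ r, u r * y r o = (∑ j, π j * ∑ r, u r * y r j) - ∑ r, p r * (y r o * u r) := by
    simp_rw [Finset.mul_sum]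
    rw [Finset.sum_comm, ← Finset.sum_sub_distrib]
    refine Finset.sum_congr rfl fun r _ => ?_
    conv_lhs => rw [← hyo r]
    rw [mul_sub, Finset.mul_sum]
    congr 1
    · exact Finset.sum_congr rfl fun j _ => by ring
    · ring
  have hprice : 0 ≤ ∑ j, π j * ((∑ i, v i * x i j) - (∑ r, u r * y r j) + w) :=
    Finset.sum_nonneg fun j _ => mul_nonneg (hπ j) (hw j)
  simp only [mul_add, mul_sub, Finset.sum_add_distrib, Finset.sum_sub_distrib] at hprice
  rw [← Finset.sum_mul, hκ] at hprice
  have hqv : (∑ i, q i) * τ ≤ ∑ i, q i * (x i o * v i) := by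
    rw [Finset.sum_mul]
    exact Finset.sum_le_sum fun i _ => mul_le_mul_of_nonneg_left (hv i) (hq i)
  have hpu : (∑ r, p r) * τ ≤ ∑ r, p r * (y r o * u r) := by
    rw [Finset.sum_mul]
    exact Finset.sum_le_sum fun r _ => mul_le_mul_of_nonneg_left (hu r) (hp r)
  linarith

/-- The intensities of a feasible triple have positive total. -/
theorem BTScTAPFeasible.scalar_pos [Nonempty R] {q : I → ℝ} {p : R → ℝ} {π : J → ℝ}
    (hy : ∀ r j, 0 < y r j) (hP : BTScTAPFeasible x y o κ q p π) : 0 < κ := by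
  obtain ⟨-, hp, hπ, -, hyo, hκ⟩ := hP
  obtain ⟨r⟩ := ‹Nonempty R›
  have hκ0 : 0 ≤ ∑ j, π j := Finset.sum_nonneg fun j _ => hπ j
  rw [← hκ]
  refine hκ0.lt_of_ne fun h => ?_
  have hzero := (Finset.sum_eq_zero_iff_of_nonneg fun j _ => hπ j).1 h.symm
  have hsum : ∑ j, y r j * π j = 0 :=
    Finset.sum_eq_zero fun j hj => by rw [hzero j hj, mul_zero]
  have := hyo r
  have := mul_nonneg (hp r) (hy r o).le
  have := hy r o
  linarith

/-- Any strict upper bound for the TAP objectives is a strict upper bound for the bTSc objective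
of some TVG-feasible triple. -/
theorem exists_btscTVGFeasible_lt [Nonempty J] [Nonempty R]
    (hx : ∀ i j, 0 < x i j) (hy : ∀ r j, 0 < y r j) {m : ℝ}
    (hTAP : ∃ q p π, BTScTAPFeasible x y o κ q p π)
    (hm : ∀ q p π, BTScTAPFeasible x y o κ q p π → τ * ((∑ i, q i) + ∑ r, p r) < m) :
    ∃ v u w, BTScTVGFeasible x y o τ v u w ∧
      (∑ i, v i * x i o) - (∑ r, u r * y r o) + κ * w < m := by
  have hκ : 0 < κ := by
    obtain ⟨q, p, π, hP⟩ := hTAP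
    exact hP.scalar_pos hy
  let A : I ⊕ R → J → ℝ :=
    Sum.elim (fun i j => x i o - κ * x i j) (fun r j => κ * y r j - y r o)
  let c : J → ℝ := fun j =>
    (∑ i, τ / x i o * (x i o - κ * x i j)) + ∑ r, τ / y r o * (κ * y r j - y r o)
  have hAx (π : J → ℝ) (hπ : ∑ j, π j = 1) (i : I) :
      ∑ j, A (.inl i) j * π j = x i o - ∑ j, x i j * (κ * π j) := by
    simp only [A, Sum.elim_inl, sub_mul, Finset.sum_sub_distrib, ← Finset.mul_sum, hπ, mul_one]
    congr 1
    exact Finset.sum_congr rfl fun j _ => by ring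
  have hAy (π : J → ℝ) (hπ : ∑ j, π j = 1) (r : R) :
      ∑ j, A (.inr r) j * π j = (∑ j, y r j * (κ * π j)) - y r o := by
    simp only [A, Sum.elim_inr, sub_mul, Finset.sum_sub_distrib, ← Finset.mul_sum, hπ, mul_one]
    congr 1
    exact Finset.sum_congr rfl fun j _ => by ring
  have hc (π : J → ℝ) : ∑ j, c j * π j =
      τ * ((∑ i, (∑ j, A (.inl i) j * π j) / x i o) +
        ∑ r, (∑ j, A (.inr r) j * π j) / y r o) := by
    simp only [c, A, Sum.elim_inl, Sum.elim_inr, add_mul, Finset.sum_add_distrib, Finset.sum_mul,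
      mul_add, Finset.mul_sum, Finset.sum_div]
    congr 1 <;> rw [Finset.sum_comm] <;>
      exact Finset.sum_congr rfl fun _ _ => Finset.sum_congr rfl fun _ _ => by ring
  obtain ⟨l, hl, hlm⟩ := exists_multipliers_of_forall_stdSimplex_lt A c m
    (by
      obtain ⟨q, p, π, hq, hp, hπ, hxo, hyo, hsum⟩ := hTAP
      have hone : ∑ j, π j / κ = 1 := by rw [← Finset.sum_div, hsum, div_self hκ.ne']
      refine ⟨fun j => π j / κ, ⟨fun j => div_nonneg (hπ j) hκ.le, hone⟩, ?_⟩
      rintro (i | r)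
      · rw [hAx _ hone]
        simp only [mul_div_cancel₀ _ hκ.ne']
        linarith [hxo i, mul_nonneg (hq i) (hx i o).le]
      · rw [hAy _ hone]
        simp only [mul_div_cancel₀ _ hκ.ne']
        linarith [hyo r, mul_nonneg (hp r) (hy r o).le])
    (by
      rintro π ⟨hπ, hone⟩ hfeas
      rw [hc]
      refine hm _ _ (fun j => κ * π j) ⟨fun i => div_nonneg (hfeas _) (hx i o).le,
        fun r => div_nonneg (hfeas _) (hy r o).le, fun j => mul_nonneg hκ.le (hπ j),
        fun i => ?_, fun r => ?_, ?_⟩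
      · rw [div_mul_cancel₀ _ (hx i o).ne', hAx π hone]
        ring
      · rw [div_mul_cancel₀ _ (hy r o).ne', hAy π hone]
        ring
      · rw [← Finset.mul_sum, hone, mul_one])
  let v : I → ℝ := fun i => l (.inl i) + τ / x i o
  let u : R → ℝ := fun r => l (.inr r) + τ / y r o
  obtain ⟨k, hk⟩ := Finite.exists_max fun j => (∑ r, u r * y r j) - ∑ i, v i * x i j
  refine ⟨v, u, (∑ r, u r * y r k) - ∑ i, v i * x i k, ⟨fun j => ?_, fun i => ?_, fun r => ?_⟩, ?_⟩
  · linarith [hk j]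
  · have : x i o * v i = x i o * l (.inl i) + τ := by
      rw [mul_add, mul_div_cancel₀ _ (hx i o).ne']
    linarith [mul_nonneg (hx i o).le (hl (.inl i))]
  · have : y r o * u r = y r o * l (.inr r) + τ := by
      rw [mul_add, mul_div_cancel₀ _ (hy r o).ne']
    linarith [mul_nonneg (hy r o).le (hl (.inr r))]
  · refine lt_of_eq_of_lt ?_ (hlm k)
    simp only [Fintype.sum_sum_type, A, c, Sum.elim_inl, Sum.elim_inr]
    have hX : (∑ i, l (.inl i) * (x i o - κ * x i k)) + ∑ i, τ / x i o * (x i o - κ * x i k)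
        = (∑ i, v i * x i o) - κ * ∑ i, v i * x i k := by
      rw [Finset.mul_sum, ← Finset.sum_add_distrib, ← Finset.sum_sub_distrib]
      exact Finset.sum_congr rfl fun i _ => by ring
    have hY : (∑ r, l (.inr r) * (κ * y r k - y r o)) + ∑ r, τ / y r o * (κ * y r k - y r o)
        = (κ * ∑ r, u r * y r k) - ∑ r, u r * y r o := by
      rw [Finset.mul_sum, ← Finset.sum_add_distrib, ← Finset.sum_sub_distrib]
      exact Finset.sum_congr rfl fun r _ => by ring
    linarith

end BTSc

/-- Strong duality for the bTSc model (Eq. (34), bTSc case): if both programs are feasible,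
the supremum of the TAP objectives over bTSc-TAP-feasible triples for `κ` equals the infimum
of the bTSc objectives over bTSc-TVG-feasible triples. -/
theorem btsc_strong_duality
    {J I R : Type*} [Fintype J] [Fintype I] [Fintype R]
    [Nonempty J] [Nonempty I] [Nonempty R]
    (x : I → J → ℝ) (y : R → J → ℝ)
    (hx : ∀ i j, 0 < x i j) (hy : ∀ r j, 0 < y r j)
    (o : J) (τ : ℝ) (hτ : 0 < τ) (κ : ℝ)
    (hTAP : ∃ q p π, BTScTAPFeasible x y o κ q p π)
    (hTVG : ∃ v u w, BTScTVGFeasible x y o τ v u w) :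
    sSup {z : ℝ | ∃ q p π, BTScTAPFeasible x y o κ q p π ∧
        z = τ * ((∑ i, q i) + (∑ r, p r))}
      = sInf {z : ℝ | ∃ v u w, BTScTVGFeasible x y o τ v u w ∧
        z = (∑ i, v i * x i o) - (∑ r, u r * y r o) + κ * w} := by
  obtain ⟨q₀, p₀, π₀, hP₀⟩ := hTAP
  obtain ⟨v₀, u₀, w₀, hD₀⟩ := hTVG
  apply le_antisymm
  · refine csSup_le ⟨_, q₀, p₀, π₀, hP₀, rfl⟩ ?_
    rintro _ ⟨q, p, π, hP, rfl⟩
    refine le_csInf ⟨_, v₀, u₀, w₀, hD₀, rfl⟩ ?_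
    rintro _ ⟨v, u, w, hD, rfl⟩
    exact hP.objective_le hD
  · refine le_of_forall_gt_imp_ge_of_dense fun m hm => ?_
    have hbdd : BddAbove {z : ℝ | ∃ q p π, BTScTAPFeasible x y o κ q p π ∧
        z = τ * ((∑ i, q i) + (∑ r, p r))} := by
      refine ⟨(∑ i, v₀ i * x i o) - (∑ r, u₀ r * y r o) + κ * w₀, ?_⟩
      rintro _ ⟨q, p, π, hP, rfl⟩
      exact hP.objective_le hD₀
    obtain ⟨v, u, w, hD, hlt⟩ := exists_btscTVGFeasible_lt (τ := τ) hx hy ⟨q₀, p₀, π₀, hP₀⟩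
      fun q p π hP => lt_of_le_of_lt (le_csSup hbdd ⟨q, p, π, hP, rfl⟩) hm
    refine le_trans (csInf_le ?_ ⟨v, u, w, hD, rfl⟩) hlt.le
    refine ⟨τ * ((∑ i, q₀ i) + ∑ r, p₀ r), ?_⟩
    rintro _ ⟨v, u, w, hD, rfl⟩
    exact hP₀.objective_le hD
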